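/- There exists ε₀′ > 0 such that for each ε ∈ (0, ε₀′] there is a function ψ ∈ C²(cl(Ω_ε)) satisfying ν_L·Dψ(z) > 0 for all z ∈ ∂_L Ω_ε, ν_B·Dψ(z) > 0 for all z ∈ ∂_B Ω_ε, and ν_T·Dψ(z) > 0 for all z ∈ ∂_T Ω_ε. -/

import Mathlib

open scoped RealInnerProductSpace
open Filter Topology Set

noncomputable section

namespace ThinDomains

abbrev EN (N : ℕ) : Type := EuclideanSpace ℝ (Fin N)

/-- The first `N` coordinates of a point of `ℝ^{N+1}`. -/
def xpart {N : ℕ} (z : EN (N + 1)) : EN N :=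
  (EuclideanSpace.equiv (Fin N) ℝ).symm fun i =>
    (EuclideanSpace.equiv (Fin (N + 1)) ℝ) z i.castSucc

/-- The last coordinate of a point of `ℝ^{N+1}`. -/
def ypart {N : ℕ} (z : EN (N + 1)) : ℝ :=
  (EuclideanSpace.equiv (Fin (N + 1)) ℝ) z (Fin.last N)

/-- The point `(x, y) ∈ ℝ^{N+1}`. -/
def app {N : ℕ} (x : EN N) (y : ℝ) : EN (N + 1) :=
  (EuclideanSpace.equiv (Fin (N + 1)) ℝ).symm
    (Fin.snoc (fun i => (EuclideanSpace.equiv (Fin N) ℝ) x i) y)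

/-- The thin domain `Ω_ε = {(x,y) : x ∈ Ω, 0 < y < ε g(x)}`. -/
def thinDomain {N : ℕ} (Ω : Set (EN N)) (g : EN N → ℝ) (ε : ℝ) : Set (EN (N + 1)) :=
  {z | xpart z ∈ Ω ∧ 0 < ypart z ∧ ypart z < ε * g (xpart z)}

/-- Lateral boundary portion of `Ω_ε`. -/
def latBd {N : ℕ} (Ω : Set (EN N)) (g : EN N → ℝ) (ε : ℝ) : Set (EN (N + 1)) :=
  {z ∈ frontier (thinDomain Ω g ε) | xpart z ∈ frontier Ω}

/-- Bottom boundary portion of `Ω_ε`. -/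
def botBd {N : ℕ} (Ω : Set (EN N)) (g : EN N → ℝ) (ε : ℝ) : Set (EN (N + 1)) :=
  {z ∈ frontier (thinDomain Ω g ε) | ypart z = 0}

/-- Top boundary portion of `Ω_ε`. -/
def topBd {N : ℕ} (Ω : Set (EN N)) (g : EN N → ℝ) (ε : ℝ) : Set (EN (N + 1)) :=
  {z ∈ frontier (thinDomain Ω g ε) | ypart z = ε * g (xpart z)}

/-- Outward unit normal to `Ω` induced by a defining function `ρ`. -/
def nuOuter {N : ℕ} (ρ : EN N → ℝ) (x : EN N) : EN N :=
  ‖gradient ρ x‖⁻¹ • gradient ρ x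

/-- Outward normal on the lateral boundary. -/
def nuL {N : ℕ} (ρ : EN N → ℝ) (z : EN (N + 1)) : EN (N + 1) :=
  app (nuOuter ρ (xpart z)) 0

/-- Outward normal on the bottom boundary: `-e_{N+1}`. -/
def nuB (N : ℕ) : EN (N + 1) :=
  -(EuclideanSpace.single (Fin.last N) (1 : ℝ))

/-- Outward normal on the top boundary. -/
def nuT {N : ℕ} (g : EN N → ℝ) (ε : ℝ) (z : EN (N + 1)) : EN (N + 1) :=
  (Real.sqrt (1 + ε ^ 2 * ‖gradient g (xpart z)‖ ^ 2))⁻¹ •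
    app (-(ε • gradient g (xpart z))) 1

/-- The Hessian matrix of `φ` at `z`. -/
def hess {N : ℕ} (φ : EN N → ℝ) (z : EN N) : Matrix (Fin N) (Fin N) ℝ :=
  Matrix.of fun i j =>
    iteratedFDeriv ℝ 2 φ z ![EuclideanSpace.single i (1 : ℝ), EuclideanSpace.single j (1 : ℝ)]

/-- Viscosity subsolution of the thin-domain Neumann problem (Pε), corner-aware. -/
def IsSubSolnEps {N : ℕ} (Ω : Set (EN N)) (ρ g : EN N → ℝ) (ε : ℝ)
    (F : Matrix (Fin (N + 1)) (Fin (N + 1)) ℝ → EN (N + 1) → ℝ → EN (N + 1) → ℝ)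
    (u : EN (N + 1) → ℝ) : Prop :=
  (∃ C : ℝ, ∀ z ∈ closure (thinDomain Ω g ε), |u z| ≤ C) ∧
  UpperSemicontinuousOn u (closure (thinDomain Ω g ε)) ∧
  ∀ φ : EN (N + 1) → ℝ, ContDiff ℝ 2 φ →
    ∀ zhat ∈ closure (thinDomain Ω g ε),
      (∀ z ∈ closure (thinDomain Ω g ε), u z - φ z ≤ u zhat - φ zhat) →
      (F (hess φ zhat) (gradient φ zhat) (u zhat) zhat ≤ 0 ∨
        (zhat ∈ latBd Ω g ε ∧ ⟪nuL ρ zhat, gradient φ zhat⟫ ≤ 0) ∨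
        (zhat ∈ botBd Ω g ε ∧ ⟪nuB N, gradient φ zhat⟫ ≤ 0) ∨
        (zhat ∈ topBd Ω g ε ∧ ⟪nuT g ε zhat, gradient φ zhat⟫ ≤ 0))

/-- Viscosity supersolution of the thin-domain Neumann problem (Pε), corner-aware. -/
def IsSuperSolnEps {N : ℕ} (Ω : Set (EN N)) (ρ g : EN N → ℝ) (ε : ℝ)
    (F : Matrix (Fin (N + 1)) (Fin (N + 1)) ℝ → EN (N + 1) → ℝ → EN (N + 1) → ℝ)
    (u : EN (N + 1) → ℝ) : Prop :=
  (∃ C : ℝ, ∀ z ∈ closure (thinDomain Ω g ε), |u z| ≤ C) ∧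
  LowerSemicontinuousOn u (closure (thinDomain Ω g ε)) ∧
  ∀ φ : EN (N + 1) → ℝ, ContDiff ℝ 2 φ →
    ∀ zhat ∈ closure (thinDomain Ω g ε),
      (∀ z ∈ closure (thinDomain Ω g ε), u zhat - φ zhat ≤ u z - φ z) →
      (0 ≤ F (hess φ zhat) (gradient φ zhat) (u zhat) zhat ∨
        (zhat ∈ latBd Ω g ε ∧ 0 ≤ ⟪nuL ρ zhat, gradient φ zhat⟫) ∨
        (zhat ∈ botBd Ω g ε ∧ 0 ≤ ⟪nuB N, gradient φ zhat⟫) ∨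
        (zhat ∈ topBd Ω g ε ∧ 0 ≤ ⟪nuT g ε zhat, gradient φ zhat⟫))

/-- Upper semicontinuous envelope of `u` relative to `s`. -/
def uscEnv {E : Type*} [MetricSpace E] (s : Set E) (u : E → ℝ) (z : E) : ℝ :=
  ⨅ r ∈ Set.Ioi (0 : ℝ), sSup (u '' {w ∈ s | dist w z < r})

/-- Lower semicontinuous envelope of `u` relative to `s`. -/
def lscEnv {E : Type*} [MetricSpace E] (s : Set E) (u : E → ℝ) (z : E) : ℝ :=
  ⨆ r ∈ Set.Ioi (0 : ℝ), sInf (u '' {w ∈ s | dist w z < r})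

/-- A bounded function is a viscosity solution of (Pε) if its semicontinuous envelopes
are sub- and supersolutions. -/
def IsSolnEps {N : ℕ} (Ω : Set (EN N)) (ρ g : EN N → ℝ) (ε : ℝ)
    (F : Matrix (Fin (N + 1)) (Fin (N + 1)) ℝ → EN (N + 1) → ℝ → EN (N + 1) → ℝ)
    (u : EN (N + 1) → ℝ) : Prop :=
  (∃ C : ℝ, ∀ z ∈ closure (thinDomain Ω g ε), |u z| ≤ C) ∧
  IsSubSolnEps Ω ρ g ε F (uscEnv (closure (thinDomain Ω g ε)) u) ∧
  IsSuperSolnEps Ω ρ g ε F (lscEnv (closure (thinDomain Ω g ε)) u)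

/-- Viscosity subsolution of the limit Neumann problem (P₀) on `Ω`. -/
def IsSubSolnLimit {N : ℕ} (Ω : Set (EN N)) (ρ : EN N → ℝ)
    (G : Matrix (Fin N) (Fin N) ℝ → EN N → ℝ → EN N → ℝ) (w : EN N → ℝ) : Prop :=
  (∃ C : ℝ, ∀ x ∈ closure Ω, |w x| ≤ C) ∧
  UpperSemicontinuousOn w (closure Ω) ∧
  ∀ φ : EN N → ℝ, ContDiff ℝ 2 φ →
    ∀ xhat ∈ closure Ω, (∀ x ∈ closure Ω, w x - φ x ≤ w xhat - φ xhat) →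
      (G (hess φ xhat) (gradient φ xhat) (w xhat) xhat ≤ 0 ∨
        (xhat ∈ frontier Ω ∧ ⟪nuOuter ρ xhat, gradient φ xhat⟫ ≤ 0))

/-- Viscosity supersolution of the limit Neumann problem (P₀) on `Ω`. -/
def IsSuperSolnLimit {N : ℕ} (Ω : Set (EN N)) (ρ : EN N → ℝ)
    (G : Matrix (Fin N) (Fin N) ℝ → EN N → ℝ → EN N → ℝ) (w : EN N → ℝ) : Prop :=
  (∃ C : ℝ, ∀ x ∈ closure Ω, |w x| ≤ C) ∧
  LowerSemicontinuousOn w (closure Ω) ∧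
  ∀ φ : EN N → ℝ, ContDiff ℝ 2 φ →
    ∀ xhat ∈ closure Ω, (∀ x ∈ closure Ω, w xhat - φ xhat ≤ w x - φ x) →
      (0 ≤ G (hess φ xhat) (gradient φ xhat) (w xhat) xhat ∨
        (xhat ∈ frontier Ω ∧ 0 ≤ ⟪nuOuter ρ xhat, gradient φ xhat⟫))

/-- Continuous viscosity solution of the limit problem (P₀). -/
def IsContViscSolnLimit {N : ℕ} (Ω : Set (EN N)) (ρ : EN N → ℝ)
    (G : Matrix (Fin N) (Fin N) ℝ → EN N → ℝ → EN N → ℝ) (w : EN N → ℝ) : Prop :=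
  ContinuousOn w (closure Ω) ∧ IsSubSolnLimit Ω ρ G w ∧ IsSuperSolnLimit Ω ρ G w

/-- `blockdiag X a ∈ S(N+1)`: `X` in the upper-left `N×N` block, `a` in the lower-right
entry, zeros elsewhere. -/
def blockdiag {N : ℕ} (X : Matrix (Fin N) (Fin N) ℝ) (a : ℝ) :
    Matrix (Fin (N + 1)) (Fin (N + 1)) ℝ :=
  Matrix.of fun i j =>
    if hi : (i : ℕ) < N then
      if hj : (j : ℕ) < N then X ⟨(i : ℕ), hi⟩ ⟨(j : ℕ), hj⟩ else 0
    else if _hj : (j : ℕ) < N then 0 else a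

/-- The limit operator `G` built from `F` and `g`. -/
def limitOp {N : ℕ} (g : EN N → ℝ)
    (F : Matrix (Fin (N + 1)) (Fin (N + 1)) ℝ → EN (N + 1) → ℝ → EN (N + 1) → ℝ)
    (X : Matrix (Fin N) (Fin N) ℝ) (p : EN N) (r : ℝ) (x : EN N) : ℝ :=
  F (blockdiag X (⟪gradient g x, p⟫ / g x)) (app p 0) r (app x 0)

/-- Upper relaxed limit of a family `U ε` of functions on the thin domains. -/
def upperRelaxed {N : ℕ} (Ω : Set (EN N)) (g : EN N → ℝ) (ε₀ : ℝ)
    (U : ℝ → EN (N + 1) → ℝ) (x : EN N) : ℝ :=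
  ⨅ r ∈ Set.Ioi (0 : ℝ),
    sSup {t | ∃ ε z, 0 < ε ∧ ε < r ∧ ε ≤ ε₀ ∧ z ∈ closure (thinDomain Ω g ε) ∧
      ‖xpart z - x‖ < r ∧ t = U ε z}

/-- Lower relaxed limit of a family `U ε` of functions on the thin domains. -/
def lowerRelaxed {N : ℕ} (Ω : Set (EN N)) (g : EN N → ℝ) (ε₀ : ℝ)
    (U : ℝ → EN (N + 1) → ℝ) (x : EN N) : ℝ :=
  ⨆ r ∈ Set.Ioi (0 : ℝ),
    sInf {t | ∃ ε z, 0 < ε ∧ ε < r ∧ ε ≤ ε₀ ∧ z ∈ closure (thinDomain Ω g ε) ∧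
      ‖xpart z - x‖ < r ∧ t = U ε z}

/-- Pucci maximal operator `M⁺_{λ,Λ}(X) = sup {tr(AX) : λI ≤ A ≤ ΛI, A symmetric}`. -/
def pucciPlus {m : ℕ} (lam Lam : ℝ) (X : Matrix (Fin m) (Fin m) ℝ) : ℝ :=
  sSup {t | ∃ A : Matrix (Fin m) (Fin m) ℝ, A.IsSymm ∧
    (A - lam • (1 : Matrix (Fin m) (Fin m) ℝ)).PosSemidef ∧
    ((Lam • (1 : Matrix (Fin m) (Fin m) ℝ)) - A).PosSemidef ∧ t = (A * X).trace}

/-- Frobenius norm of a matrix. -/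
def matNorm {N : ℕ} (X : Matrix (Fin N) (Fin N) ℝ) : ℝ :=
  Real.sqrt (∑ i, ∑ j, (X i j) ^ 2)

theorem exists_contDiff_fderiv_dist_le {E : Type*} [NormedAddCommGroup E] [InnerProductSpace ℝ E]
    [FiniteDimensional ℝ E] {f : E → ℝ} (hf : ContDiff ℝ 1 f) {K : Set E} (hK : IsCompact K)
    {δ : ℝ} (hδ : 0 < δ) (n : ℕ∞) :
    ∃ h : E → ℝ, ContDiff ℝ n h ∧ ∀ x ∈ K, dist (fderiv ℝ h x) (fderiv ℝ f x) ≤ δ := by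
  borelize E
  obtain ⟨R, hR, hKR⟩ := hK.isBounded.subset_ball_lt 0 0
  let χ : ContDiffBump (0 : E) := ⟨R, R + 1, hR, by linarith⟩
  let F : E → ℝ := fun x => χ x * f x
  have hF : ContDiff ℝ 1 F := χ.contDiff.mul hf
  have hFc : HasCompactSupport F := χ.hasCompactSupport.mul_right
  have hFf : ∀ x ∈ K, fderiv ℝ F x = fderiv ℝ f x := fun x hx => by
    refine Filter.EventuallyEq.fderiv_eq ?_
    filter_upwards [χ.eventuallyEq_one_of_mem_ball (hKR hx)] with y hy
    simp [F, hy]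
  have hcont : Continuous (fderiv ℝ F) := hF.continuous_fderiv one_ne_zero
  obtain ⟨r, hr, hclose⟩ := Metric.uniformContinuous_iff.1
    (hcont.uniformContinuous_of_tendsto_cocompact (hFc.fderiv ℝ).is_zero_at_infty) δ hδ
  let φ : ContDiffBump (0 : E) := ⟨r / 2, r, by linarith, by linarith⟩
  let μ : MeasureTheory.Measure E := MeasureTheory.Measure.addHaar
  refine ⟨MeasureTheory.convolution (φ.normed μ) F (ContinuousLinearMap.lsmul ℝ ℝ) μ,
    φ.hasCompactSupport_normed.contDiff_convolution_left _ φ.contDiff_normed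
      hF.continuous.locallyIntegrable, fun x hx => ?_⟩
  rw [(hFc.hasFDerivAt_convolution_right (ContinuousLinearMap.lsmul ℝ ℝ)
    φ.continuous_normed.locallyIntegrable hF x).fderiv, ← hFf x hx]
  exact φ.dist_normed_convolution_le (μ := μ) hcont.aestronglyMeasurable
    fun y hy => (hclose hy).le

/-- `xpart` as a continuous linear map. -/
def xpartL (N : ℕ) : EN (N + 1) →L[ℝ] EN N :=
  LinearMap.toContinuousLinearMap
    { toFun := xpart
      map_add' := fun _ _ => rfl
      map_smul' := fun _ _ => rfl }

/-- `ypart` as a continuous linear map. -/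
def ypartL (N : ℕ) : EN (N + 1) →L[ℝ] ℝ :=
  LinearMap.toContinuousLinearMap
    { toFun := ypart
      map_add' := fun _ _ => rfl
      map_smul' := fun _ _ => rfl }

@[simp]
theorem xpartL_apply {N : ℕ} (z : EN (N + 1)) : xpartL N z = xpart z := rfl

@[simp]
theorem ypartL_apply {N : ℕ} (z : EN (N + 1)) : ypartL N z = ypart z := rfl

@[simp]
theorem xpart_app {N : ℕ} (x : EN N) (y : ℝ) : xpart (app x y) = x := by
  ext i
  simp [xpart, app]

@[simp]
theorem ypart_app {N : ℕ} (x : EN N) (y : ℝ) : ypart (app x y) = y := by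
  simp [ypart, app]

theorem nuB_eq_app (N : ℕ) : nuB N = app 0 (-1) := by
  ext i
  refine Fin.lastCases ?_ (fun j => ?_) i
  · simp [nuB, app]
  · simp [nuB, app]

theorem xpart_mem_closure {N : ℕ} {Ω : Set (EN N)} {g : EN N → ℝ} {ε : ℝ} {z : EN (N + 1)}
    (hz : z ∈ frontier (thinDomain Ω g ε)) : xpart z ∈ closure Ω :=
  map_mem_closure (xpartL N).continuous (frontier_subset_closure hz) fun _ hw => hw.1

theorem inner_gradient_eq_fderiv {E : Type*} [NormedAddCommGroup E] [InnerProductSpace ℝ E]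
    [CompleteSpace E] (f : E → ℝ) (x v : E) : ⟪v, gradient f x⟫ = fderiv ℝ f x v := by
  rw [real_inner_comm, ← toDual_gradient, InnerProductSpace.toDual_apply_apply]

theorem inner_app_gradient {N : ℕ} {h : EN N → ℝ} (hh : Differentiable ℝ h) (A δ : ℝ)
    (z : EN (N + 1)) (v : EN N) (t : ℝ) :
    ⟪app v t, gradient (fun w => h (xpart w) + A * (ypart w - δ) ^ 2) z⟫ =
      fderiv ℝ h (xpart z) v + 2 * A * (ypart z - δ) * t := by
  have h1 := (hh (xpart z)).hasFDerivAt.comp z (xpartL N).hasFDerivAt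
  have h2 := ((((ypartL N).hasFDerivAt (x := z)).sub_const δ).pow 2).const_mul A
  have h3 : HasFDerivAt (fun w => h (xpart w) + A * (ypart w - δ) ^ 2) _ z := h1.add h2
  rw [inner_gradient_eq_fderiv, h3.fderiv]
  simp
  ring

/-- A function that is `C¹` is approximated by a `C²` function which still increases along the
gradient at every point of a compact set free of critical points. -/
theorem exists_contDiff_two_fderiv_gradient_pos {E : Type*} [NormedAddCommGroup E]
    [InnerProductSpace ℝ E] [FiniteDimensional ℝ E] {ρ : E → ℝ} (hρ : ContDiff ℝ 1 ρ)
    {K : Set E} (hK : IsCompact K) (hgrad : ∀ x ∈ K, gradient ρ x ≠ 0) :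
    ∃ h : E → ℝ, ContDiff ℝ 2 h ∧ ∀ x ∈ K, 0 < fderiv ℝ h x (gradient ρ x) := by
  have hcont : Continuous (gradient ρ) :=
    (InnerProductSpace.toDual ℝ E).symm.continuous.comp (hρ.continuous_fderiv one_ne_zero)
  obtain ⟨c, hc, hKc⟩ := hK.exists_forall_le' hcont.norm.continuousOn
    fun x hx => norm_pos_iff.2 (hgrad x hx)
  obtain ⟨h, hh, happrox⟩ := exists_contDiff_fderiv_dist_le hρ hK (half_pos hc) 2
  refine ⟨h, hh, fun x hx => ?_⟩
  have h1 := (fderiv ℝ h x - fderiv ℝ ρ x).le_of_opNorm_le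
    ((dist_eq_norm _ _).symm.trans_le (happrox x hx)) (gradient ρ x)
  have h2 : fderiv ℝ ρ x (gradient ρ x) = ‖gradient ρ x‖ ^ 2 := by
    rw [← inner_gradient_eq_fderiv, real_inner_self_eq_norm_sq]
  rw [sub_apply, h2, Real.norm_eq_abs] at h1
  have h3 := (abs_le.1 h1).1
  nlinarith [hKc x hx]

/-- existence of a strictly-increasing-in-the-normal-direction C² function ψ on the thin domain. -/
theorem statement3
    (N : ℕ) (hN : 0 < N)
    (Ω : Set (EN N)) (hΩopen : IsOpen Ω) (hΩbdd : Bornology.IsBounded Ω)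
    (ρ : EN N → ℝ) (hρC : ContDiff ℝ 1 ρ)
    (hρneg : ∀ x ∈ Ω, ρ x < 0)
    (hρpos : ∀ x, x ∉ closure Ω → 0 < ρ x)
    (hρgrad : ∀ x ∈ frontier Ω, gradient ρ x ≠ 0)
    (g : EN N → ℝ) (hgC : ContDiff ℝ 1 g)
    (m M : ℝ) (hm : 0 < m) (hgm : ∀ x ∈ closure Ω, m ≤ g x) (hgM : ∀ x ∈ closure Ω, g x ≤ M)
    (ε₀ : ℝ) (hε₀ : 0 < ε₀)
    :
    ∃ ε₀' : ℝ, 0 < ε₀' ∧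
      ∀ ε : ℝ, 0 < ε → ε ≤ ε₀' →
        ∃ ψ : EN (N + 1) → ℝ, ContDiff ℝ 2 ψ ∧
          (∀ z ∈ latBd Ω g ε, 0 < ⟪nuL ρ z, gradient ψ z⟫) ∧
          (∀ z ∈ botBd Ω g ε, 0 < ⟪nuB N, gradient ψ z⟫) ∧
          (∀ z ∈ topBd Ω g ε, 0 < ⟪nuT g ε z, gradient ψ z⟫) := by
  have hcomp : IsCompact (closure Ω) := hΩbdd.isCompact_closure
  obtain ⟨h, hh, hpos⟩ := exists_contDiff_two_fderiv_gradient_pos hρC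
    (hcomp.of_isClosed_subset isClosed_frontier frontier_subset_closure) hρgrad
  have hcont : Continuous fun x => fderiv ℝ h x (gradient g x) :=
    (hh.continuous_fderiv two_ne_zero).clm_apply
      ((InnerProductSpace.toDual ℝ (EN N)).symm.continuous.comp
        (hgC.continuous_fderiv one_ne_zero))
  obtain ⟨C, hC⟩ := hcomp.exists_bound_of_continuousOn hcont.continuousOn
  have hd : Differentiable ℝ h := hh.differentiable two_ne_zero
  obtain ⟨A, hA, hAC⟩ : ∃ A : ℝ, 0 < A ∧ C < A * m := by
    refine ⟨(|C| + 1) / m, by positivity, ?_⟩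
    rw [div_mul_cancel₀ _ hm.ne']
    linarith [le_abs_self C]
  refine ⟨1, one_pos, fun ε hε _ =>
    ⟨fun w => h (xpart w) + A * (ypart w - ε * m / 2) ^ 2, ?_, ?_, ?_, ?_⟩⟩
  · exact (hh.comp (xpartL N).contDiff).add
      (contDiff_const.mul (((ypartL N).contDiff.sub contDiff_const).pow 2))
  · intro z hz
    rw [nuL, inner_app_gradient hd, nuOuter, map_smul, smul_eq_mul, mul_zero, add_zero]
    exact mul_pos (inv_pos.2 (norm_pos_iff.2 (hρgrad _ hz.2))) (hpos _ hz.2)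
  · intro z hz
    rw [nuB_eq_app, inner_app_gradient hd, hz.2, map_zero]
    have : 0 < A * (ε * m) := by positivity
    linarith
  · intro z hz
    have hx := xpart_mem_closure hz.1
    rw [nuT, real_inner_smul_left, inner_app_gradient hd, hz.2, map_neg, map_smul, smul_eq_mul]
    refine mul_pos (inv_pos.2 (Real.sqrt_pos.2 (by positivity))) ?_
    have h1 : fderiv ℝ h (xpart z) (gradient g (xpart z)) ≤ C :=
      (le_abs_self _).trans (hC _ hx)
    have h2 : A * m ≤ A * (2 * g (xpart z) - m) :=
      mul_le_mul_of_nonneg_left (by linarith [hgm _ hx]) hA.le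
    have h3 := mul_pos hε (show 0 < A * (2 * g (xpart z) - m) -
      fderiv ℝ h (xpart z) (gradient g (xpart z)) by linarith)
    linarith

end ThinDomains
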